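/- Main theorem (binomial model): For p ∈ (0,1), let S be the random subset of {0,1}^d containing each point independently with probability p, and let P = conv(S). Then, with probability tending to 1 as d → ∞ (uniformly over p), the edge expansion of the graph of P is at least 1/(12d). -/

import Mathlib

open scoped BigOperators Classical

/-- A face of `P ⊆ ℝ^d`: the subset of `P` where a linear functional valid on `P`
attains the value `c₀`. -/
def IsFaceOf {d : ℕ} (P F : Set (Fin d → ℝ)) : Prop :=
  ∃ (c : Fin d → ℝ) (c₀ : ℝ), (∀ x ∈ P, ∑ i, c i * x i ≤ c₀) ∧
    F = {x ∈ P | ∑ i, c i * x i = c₀}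

/-- A vertex of `P` is a point whose singleton is a face of `P`. -/
def IsVertexOf {d : ℕ} (P : Set (Fin d → ℝ)) (v : Fin d → ℝ) : Prop := IsFaceOf P {v}

/-- An edge of `P` is a segment between two distinct points that is a face of `P`. -/
def IsEdgeOf {d : ℕ} (P : Set (Fin d → ℝ)) (u v : Fin d → ℝ) : Prop :=
  u ≠ v ∧ IsFaceOf P (segment ℝ u v)

/-- The vertex set of `P`. -/
def polyVerts {d : ℕ} (P : Set (Fin d → ℝ)) : Set (Fin d → ℝ) := {v | IsVertexOf P v}

/-- The number of edges of `P` with exactly one endpoint in `S`, counted as ordered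
pairs `(u, v)` with `u ∈ S` and `v ∉ S`, so each crossing edge is counted once. -/
noncomputable def cutCard {d : ℕ} (P S : Set (Fin d → ℝ)) : ℕ :=
  {e : (Fin d → ℝ) × (Fin d → ℝ) | IsEdgeOf P e.1 e.2 ∧ e.1 ∈ S ∧ e.2 ∉ S}.ncard

/-- The edge expansion of the graph of `P` is at least `α`. -/
def ExpansionAtLeast {d : ℕ} (P : Set (Fin d → ℝ)) (α : ℝ) : Prop :=
  ∀ S : Set (Fin d → ℝ), S ⊆ polyVerts P → S.Nonempty →
    2 * S.ncard ≤ (polyVerts P).ncard → α * S.ncard ≤ cutCard P S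

/-- The embedding of `{0,1}^d` (as `Fin d → Fin 2`) into `ℝ^d`. -/
def toCube {d : ℕ} (w : Fin d → Fin 2) : Fin d → ℝ := fun i => ((w i : ℕ) : ℝ)

/-- The probability of the event `A` when a random subset of `{0,1}^d` (encoded by its
indicator `ω : (Fin d → Fin 2) → Bool`) is chosen by including each point independently
with probability `p`. -/
noncomputable def binomProb (d : ℕ) (p : ℝ) (A : Set ((Fin d → Fin 2) → Bool)) : ℝ :=
  ∑ ω ∈ Finset.univ.filter (· ∈ A),
    ∏ v : Fin d → Fin 2, (if ω v then p else 1 - p)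

theorem isLinearMap_sum_mul {d : ℕ} (c : Fin d → ℝ) :
    IsLinearMap ℝ fun x : Fin d → ℝ => ∑ i, c i * x i := by
  constructor
  · intro x y
    simp [mul_add, Finset.sum_add_distrib]
  · intro a x
    simp [Finset.mul_sum, mul_left_comm]

/-- The face of a convex hull cut out by a valid inequality is the convex hull of the generators
attaining equality. -/
theorem setOf_eq_convexHull {d : ℕ} (s : Set (Fin d → ℝ)) (c : Fin d → ℝ) (c₀ : ℝ)
    (h : ∀ x ∈ s, ∑ i, c i * x i ≤ c₀) :
    {x ∈ convexHull ℝ s | ∑ i, c i * x i = c₀} =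
      convexHull ℝ {x ∈ s | ∑ i, c i * x i = c₀} := by
  have hlin := isLinearMap_sum_mul c
  apply Set.Subset.antisymm
  · rintro x ⟨hx, hxc⟩
    set Y := {x ∈ s | ∑ i, c i * x i = c₀} with hY
    set Z := {x ∈ s | ∑ i, c i * x i < c₀} with hZ
    have hs : s = Y ∪ Z := by
      ext y
      constructor
      · intro hy
        rcases (h y hy).lt_or_eq with h1 | h1
        · exact Or.inr ⟨hy, h1⟩
        · exact Or.inl ⟨hy, h1⟩
      · rintro (hy | hy)
        exacts [hy.1, hy.1]
    have hZlt : ∀ z ∈ convexHull ℝ Z, ∑ i, c i * z i < c₀ := fun z hz =>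
      convexHull_min (fun y hy => hy.2) (convex_halfSpace_lt hlin c₀) hz
    have hYeq : ∀ z ∈ convexHull ℝ Y, ∑ i, c i * z i = c₀ := fun z hz =>
      convexHull_min (fun y hy => hy.2) (convex_hyperplane hlin c₀) hz
    rcases Y.eq_empty_or_nonempty with hYe | hYn
    · rw [hs, hYe, Set.empty_union] at hx
      exact absurd hxc (hZlt x hx).ne
    rcases Z.eq_empty_or_nonempty with hZe | hZn
    · rwa [hs, hZe, Set.union_empty] at hx
    rw [hs, convexHull_union hYn hZn, mem_convexJoin] at hx
    obtain ⟨y, hy, z, hz, a, b, ha, hb, hab, rfl⟩ := hx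
    have hval : ∑ i, c i * (a • y + b • z) i = a * c₀ + b * ∑ i, c i * z i := by
      have := hlin.map_add (a • y) (b • z)
      rw [hlin.map_smul, hlin.map_smul] at this
      simpa [hYeq y hy] using this
    have hzlt := hZlt z hz
    have hb0 : b = 0 := by
      by_contra hne
      have hbpos : 0 < b := lt_of_le_of_ne hb (Ne.symm hne)
      rw [hval, eq_sub_of_add_eq hab] at hxc
      linarith [mul_lt_mul_of_pos_left hzlt hbpos]
    have ha1 : a = 1 := by linarith
    simpa [hb0, ha1] using hy
  · intro x hx
    exact ⟨convexHull_mono (fun y hy => hy.1) hx,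
      convexHull_min (fun y hy => hy.2) (convex_hyperplane hlin c₀) hx⟩

theorem isFaceOf_convexHull {d : ℕ} {s t : Set (Fin d → ℝ)} (hts : t ⊆ s) (c : Fin d → ℝ) (c₀ : ℝ)
    (ht : ∀ x ∈ t, ∑ i, c i * x i = c₀) (hs : ∀ x ∈ s, x ∉ t → ∑ i, c i * x i < c₀) :
    IsFaceOf (convexHull ℝ s) (convexHull ℝ t) := by
  have hle : ∀ x ∈ s, ∑ i, c i * x i ≤ c₀ := fun x hx => by
    by_cases hxt : x ∈ t
    · exact (ht x hxt).le
    · exact (hs x hx hxt).le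
  refine ⟨c, c₀, fun x hx =>
    convexHull_min hle (convex_halfSpace_le (isLinearMap_sum_mul c) c₀) hx, ?_⟩
  rw [setOf_eq_convexHull s c c₀ hle]
  congr 1
  ext x
  refine ⟨fun hx => ⟨hts hx, ht x hx⟩, fun hx => ?_⟩
  by_contra hxt
  exact (hs x hx.1 hxt).ne hx.2

theorem IsFaceOf.isExtreme {d : ℕ} {P F : Set (Fin d → ℝ)} (h : IsFaceOf P F) :
    IsExtreme ℝ P F := by
  obtain ⟨c, c₀, hle, rfl⟩ := h
  have hlin := isLinearMap_sum_mul c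
  refine ⟨fun x hx => hx.1, ?_⟩
  rintro x hx y hy z hz ⟨a, b, ha, hb, hab, rfl⟩
  refine ⟨hx, le_antisymm (hle x hx) ?_⟩
  have hzc := hz.2
  have := hlin.map_add (a • x) (b • y)
  rw [hlin.map_smul, hlin.map_smul] at this
  rw [this] at hzc
  simp only [smul_eq_mul] at hzc
  have hyc := hle y hy
  by_contra! hlt
  rw [eq_sub_of_add_eq hab] at hzc
  have ha' : 0 < 1 - b := by linarith
  linarith [mul_lt_mul_of_pos_left hlt ha', mul_le_mul_of_nonneg_left hyc hb.le]

theorem IsVertexOf.mem_of_convexHull {d : ℕ} {s : Set (Fin d → ℝ)} {v : Fin d → ℝ}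
    (h : IsVertexOf (convexHull ℝ s) v) : v ∈ s :=
  extremePoints_convexHull_subset (isExtreme_singleton.1 (IsFaceOf.isExtreme h))

theorem right_mem_extremePoints_segment {d : ℕ} {u v : Fin d → ℝ} (huv : u ≠ v) :
    v ∈ (segment ℝ u v).extremePoints ℝ := by
  refine ⟨right_mem_segment ℝ u v, ?_⟩
  intro x hx y hy hv
  rw [segment_eq_image'] at hx hy
  obtain ⟨s, hs, rfl⟩ := hx
  obtain ⟨t, ht, rfl⟩ := hy
  obtain ⟨a, b, ha, hb, hab, hv⟩ := hv
  obtain ⟨i, hi⟩ := Function.ne_iff.1 huv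
  have hvi := congrFun hv i
  simp only [Pi.add_apply, Pi.smul_apply, Pi.sub_apply, smul_eq_mul] at hvi
  have hb' : b = 1 - a := by linarith
  have hprod : (a * (1 - s) + b * (1 - t)) * (u i - v i) = 0 := by
    subst hb'
    linear_combination hvi
  have hsum : a * (1 - s) + b * (1 - t) = 0 :=
    (mul_eq_zero.1 hprod).resolve_right (sub_ne_zero.2 hi)
  have hs1 : s = 1 := by
    by_contra hne
    have : s < 1 := lt_of_le_of_ne hs.2 hne
    nlinarith [mul_pos ha (sub_pos.2 this), mul_nonneg hb.le (sub_nonneg.2 ht.2)]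
  simp [hs1]

theorem IsEdgeOf.right_mem_of_convexHull {d : ℕ} {s : Set (Fin d → ℝ)} {u v : Fin d → ℝ}
    (h : IsEdgeOf (convexHull ℝ s) u v) : v ∈ s :=
  extremePoints_convexHull_subset
    (h.2.isExtreme.extremePoints_subset_extremePoints (right_mem_extremePoints_segment h.1))

theorem toCube_injective {d : ℕ} : Function.Injective (toCube : (Fin d → Fin 2) → Fin d → ℝ) := by
  intro v w h
  ext i
  have := congrFun h i
  simpa [toCube] using this

/-- Reflecting the coordinates so that `v` becomes the origin turns the linear functional with
weights `a` into the total weight of the coordinates where `y` differs from `v`. -/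
theorem sum_reflected_mul_toCube {d : ℕ} (a : Fin d → ℝ) (v y : Fin d → Fin 2) :
    ∑ i, a i * (1 - 2 * toCube v i) * toCube y i =
      ∑ i, a i * (1 - 2 * toCube v i) * toCube v i + ∑ i, if y i = v i then 0 else a i := by
  rw [← Finset.sum_add_distrib]
  refine Finset.sum_congr rfl fun i _ => ?_
  unfold toCube
  generalize v i = p
  generalize y i = q
  fin_cases p <;> fin_cases q <;> norm_num

theorem polyVerts_convexHull_toCube {d : ℕ} (X : Set (Fin d → Fin 2)) :
    polyVerts (convexHull ℝ (toCube '' X)) = toCube '' X := by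
  refine Set.Subset.antisymm (fun v hv => IsVertexOf.mem_of_convexHull hv) ?_
  rintro _ ⟨v, hv, rfl⟩
  have key : IsFaceOf (convexHull ℝ (toCube '' X)) (convexHull ℝ {toCube v}) := by
    refine isFaceOf_convexHull (Set.singleton_subset_iff.2 ⟨v, hv, rfl⟩)
      (fun i => (-1) * (1 - 2 * toCube v i)) (∑ i, (-1) * (1 - 2 * toCube v i) * toCube v i) ?_ ?_
    · rintro _ rfl
      rfl
    · rintro _ ⟨y, -, rfl⟩ hne
      rw [sum_reflected_mul_toCube (fun _ => -1) v y, add_lt_iff_neg_left]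
      have hyv : y ≠ v := fun h => hne (by simp [h])
      obtain ⟨i, hi⟩ := Function.ne_iff.1 hyv
      refine Finset.sum_neg' (fun i _ => ?_) ⟨i, Finset.mem_univ i, ?_⟩
      · split_ifs <;> norm_num
      · simp [hi]
  rwa [convexHull_singleton] at key

/-- If `w` is the only point of `X` in the smallest cube face containing `v` and `w` whose `j`-th
coordinate differs from that of `v`, then this face of the polytope is a pyramid with apex `w`, and
`v`, `w` are adjacent. -/
theorem isEdgeOf_toCube {d : ℕ} {X : Set (Fin d → Fin 2)} {v w : Fin d → Fin 2} (hv : v ∈ X)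
    (hw : w ∈ X) (j : Fin d) (hj : w j ≠ v j)
    (h : ∀ y ∈ X, (∀ i, y i = v i ∨ y i = w i) → y j = v j ∨ y = w) :
    IsEdgeOf (convexHull ℝ (toCube '' X)) (toCube v) (toCube w) := by
  refine ⟨fun h => hj (congrFun (toCube_injective h).symm j), ?_⟩
  set n : ℝ := ∑ i, if i = j then 0 else if w i = v i then 0 else 1 with hn
  have hn0 : 0 ≤ n := Finset.sum_nonneg fun i _ => by split_ifs <;> norm_num
  set a : Fin d → ℝ := fun i => if i = j then n else if w i = v i then -(n + 1) else -1 with ha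
  have haj : a j = n := if_pos rfl
  have hlt : ∀ i, i ≠ j → a i < 0 := fun i hi => by
    simp only [ha, hi, if_false]
    split_ifs <;> linarith
  rw [← convexHull_pair]
  refine isFaceOf_convexHull (Set.pair_subset ⟨v, hv, rfl⟩ ⟨w, hw, rfl⟩)
    (fun i => a i * (1 - 2 * toCube v i)) (∑ i, a i * (1 - 2 * toCube v i) * toCube v i) ?_ ?_
  · rintro _ (rfl | rfl)
    · rfl
    · rw [sum_reflected_mul_toCube a v w, add_eq_left,
        ← Finset.add_sum_erase _ _ (Finset.mem_univ j), if_neg hj, haj, hn,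
        ← Finset.add_sum_erase _ _ (Finset.mem_univ j), if_pos rfl, zero_add,
        ← Finset.sum_add_distrib]
      refine Finset.sum_eq_zero fun i hi => ?_
      have hij := Finset.ne_of_mem_erase hi
      simp only [ha, hij, if_false]
      split_ifs <;> norm_num
  · rintro _ ⟨y, hy, rfl⟩ hne
    rw [sum_reflected_mul_toCube a v y, add_lt_iff_neg_left]
    have hyv : y ≠ v := fun h => hne (by simp [h])
    have hyw : y ≠ w := fun h => hne (by simp [h])
    by_cases hC : ∀ i, y i = v i ∨ y i = w i
    · have hyj := (h y hy hC).resolve_right hyw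
      obtain ⟨i, hi⟩ := Function.ne_iff.1 hyv
      refine Finset.sum_neg' (fun i _ => ?_) ⟨i, Finset.mem_univ i, ?_⟩
      · by_cases hij : i = j
        · simp [hij, hyj]
        · split_ifs
          exacts [le_rfl, (hlt i hij).le]
      · rw [if_neg hi]
        exact hlt i fun hij => hi (hij ▸ hyj)
    · push Not at hC
      obtain ⟨i, hiv, hiw⟩ := hC
      have hwv : w i = v i := by
        revert hiv hiw
        generalize y i = p
        generalize w i = q
        generalize v i = r
        revert p q r
        decide
      have hij : i ≠ j := fun hij => hj (hij ▸ hwv)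
      rw [← Finset.add_sum_erase _ _ (Finset.mem_univ j), ← Finset.add_sum_erase _ _
        (Finset.mem_erase.2 ⟨hij, Finset.mem_univ i⟩)]
      have h1 : (if y j = v j then 0 else a j) ≤ n := by
        split_ifs
        · exact hn0
        · simp [ha]
      have h2 : (if y i = v i then 0 else a i) = -(n + 1) := by
        simp [ha, hiv, hij, hwv]
      have h3 : ∑ l ∈ (Finset.univ.erase j).erase i, (if y l = v l then 0 else a l) ≤ 0 := by
        refine Finset.sum_nonpos fun l hl => ?_
        split_ifs
        exacts [le_rfl, (hlt l (Finset.ne_of_mem_erase (Finset.mem_of_mem_erase hl))).le]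
      linarith

/-- Two points of the discrete cube are adjacent if they differ in exactly one coordinate. -/
def CubeAdj {m : ℕ} (x y : Fin m → Fin 2) : Prop := ∃ i, ∀ j, x j ≠ y j ↔ j = i

/-- The pairs of adjacent points of the discrete cube leaving `F`. -/
noncomputable def cubeBoundary {m : ℕ} (F : Finset (Fin m → Fin 2)) :
    Finset ((Fin m → Fin 2) × (Fin m → Fin 2)) :=
  Finset.univ.filter fun e => e.1 ∈ F ∧ e.2 ∉ F ∧ CubeAdj e.1 e.2

theorem mem_cubeBoundary {m : ℕ} {F : Finset (Fin m → Fin 2)}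
    {e : (Fin m → Fin 2) × (Fin m → Fin 2)} :
    e ∈ cubeBoundary F ↔ e.1 ∈ F ∧ e.2 ∉ F ∧ CubeAdj e.1 e.2 := by
  simp [cubeBoundary]

theorem CubeAdj.symm {m : ℕ} {x y : Fin m → Fin 2} (h : CubeAdj x y) : CubeAdj y x :=
  h.imp fun _ hi j => ne_comm.trans (hi j)

theorem CubeAdj.cons {m : ℕ} {x y : Fin m → Fin 2} (h : CubeAdj x y) (a : Fin 2) :
    CubeAdj (Fin.cons a x : Fin (m + 1) → Fin 2) (Fin.cons a y) := by
  obtain ⟨i, hi⟩ := h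
  refine ⟨i.succ, fun j => ?_⟩
  refine Fin.cases ?_ (fun j => ?_) j
  · simp [(Fin.succ_ne_zero i).symm]
  · simp only [Fin.cons_succ, Fin.succ_inj]
    exact hi j

theorem cubeAdj_cons_of_ne {m : ℕ} (x : Fin m → Fin 2) {a b : Fin 2} (h : a ≠ b) :
    CubeAdj (Fin.cons a x : Fin (m + 1) → Fin 2) (Fin.cons b x) := by
  refine ⟨0, fun j => ?_⟩
  refine Fin.cases ?_ (fun j => ?_) j
  · simpa using h
  · simp

/-- The part of `F` with first coordinate `a`, projected to the remaining coordinates. -/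
noncomputable def cubeSlice {m : ℕ} (F : Finset (Fin (m + 1) → Fin 2)) (a : Fin 2) :
    Finset (Fin m → Fin 2) :=
  Finset.univ.filter fun x => (Fin.cons a x : Fin (m + 1) → Fin 2) ∈ F

theorem mem_cubeSlice {m : ℕ} {F : Finset (Fin (m + 1) → Fin 2)} {a : Fin 2} {x : Fin m → Fin 2} :
    x ∈ cubeSlice F a ↔ (Fin.cons a x : Fin (m + 1) → Fin 2) ∈ F := by
  simp [cubeSlice]

theorem card_cubeSlice_add {m : ℕ} (F : Finset (Fin (m + 1) → Fin 2)) :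
    (cubeSlice F 0).card + (cubeSlice F 1).card = F.card := by
  have hF : F = (cubeSlice F 0).image (Fin.cons 0 : _ → Fin (m + 1) → Fin 2) ∪
      (cubeSlice F 1).image (Fin.cons 1 : _ → Fin (m + 1) → Fin 2) := by
    ext x
    refine Fin.consCases (fun a x => ?_) x
    fin_cases a <;> simp [mem_cubeSlice, Fin.cons_inj]
  conv_rhs => rw [hF]
  rw [Finset.card_union_of_disjoint, Finset.card_image_of_injective _ (Fin.cons_right_injective _),
    Finset.card_image_of_injective _ (Fin.cons_right_injective _)]
  rw [Finset.disjoint_left]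
  intro x hx hx'
  obtain ⟨y, -, rfl⟩ := Finset.mem_image.1 hx
  obtain ⟨z, -, hz⟩ := Finset.mem_image.1 hx'
  simpa using congrFun hz 0

theorem card_cubeBoundary_slices_le {m : ℕ} (F : Finset (Fin (m + 1) → Fin 2)) :
    (cubeBoundary (cubeSlice F 0)).card + (cubeBoundary (cubeSlice F 1)).card +
      (cubeSlice F 0 \ cubeSlice F 1).card + (cubeSlice F 1 \ cubeSlice F 0).card ≤
      (cubeBoundary F).card := by
  set c : Fin 2 → (Fin m → Fin 2) → Fin (m + 1) → Fin 2 :=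
    fun a x => Fin.cons a x with hc
  have hci : ∀ a, Function.Injective (c a) := fun a =>
    Fin.cons_right_injective (α := fun _ => Fin 2) a
  set T₀ := (cubeBoundary (cubeSlice F 0)).image (Prod.map (c 0) (c 0))
  set T₁ := (cubeBoundary (cubeSlice F 1)).image (Prod.map (c 1) (c 1))
  set U₀ := (cubeSlice F 0 \ cubeSlice F 1).image fun x => (c 0 x, c 1 x)
  set U₁ := (cubeSlice F 1 \ cubeSlice F 0).image fun x => (c 1 x, c 0 x)
  have hT : ∀ a, ∀ e ∈ (cubeBoundary (cubeSlice F a)).image (Prod.map (c a) (c a)),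
      e.1 0 = a ∧ e.2 0 = a ∧ e ∈ cubeBoundary F := by
    intro a e he
    obtain ⟨⟨x, y⟩, h, rfl⟩ := Finset.mem_image.1 he
    obtain ⟨h1, h2, h3⟩ := mem_cubeBoundary.1 h
    exact ⟨rfl, rfl, mem_cubeBoundary.2
      ⟨mem_cubeSlice.1 h1, fun h => h2 (mem_cubeSlice.2 h), h3.cons a⟩⟩
  have hU : ∀ a b, a ≠ b → ∀ e ∈ (cubeSlice F a \ cubeSlice F b).image fun x => (c a x, c b x),
      e.1 0 = a ∧ e.2 0 = b ∧ e ∈ cubeBoundary F := by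
    intro a b hab e he
    obtain ⟨x, h, rfl⟩ := Finset.mem_image.1 he
    obtain ⟨h1, h2⟩ := Finset.mem_sdiff.1 h
    exact ⟨rfl, rfl, mem_cubeBoundary.2
      ⟨mem_cubeSlice.1 h1, fun h => h2 (mem_cubeSlice.2 h), cubeAdj_cons_of_ne x hab⟩⟩
  have hUi : ∀ a b, Function.Injective fun x => (c a x, c b x) :=
    fun a b x y h => hci a (Prod.ext_iff.1 h).1
  have hd₁ : Disjoint T₀ T₁ := Finset.disjoint_left.2 fun e h h' =>
    absurd ((hT 0 e h).1.symm.trans (hT 1 e h').1) (by decide)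
  have hd₂ : Disjoint (T₀ ∪ T₁) U₀ := by
    refine Finset.disjoint_left.2 fun e h h' => ?_
    obtain ⟨h3, h4, -⟩ := hU 0 1 (by decide) e h'
    rcases Finset.mem_union.1 h with h | h
    · exact absurd ((hT 0 e h).2.1.symm.trans h4) (by decide)
    · exact absurd ((hT 1 e h).1.symm.trans h3) (by decide)
  have hd₃ : Disjoint (T₀ ∪ T₁ ∪ U₀) U₁ := by
    refine Finset.disjoint_left.2 fun e h h' => ?_
    obtain ⟨h3, h4, -⟩ := hU 1 0 (by decide) e h'
    rcases Finset.mem_union.1 h with h | h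
    · rcases Finset.mem_union.1 h with h | h
      · exact absurd ((hT 0 e h).1.symm.trans h3) (by decide)
      · exact absurd ((hT 1 e h).2.1.symm.trans h4) (by decide)
    · exact absurd ((hU 0 1 (by decide) e h).1.symm.trans h3) (by decide)
  rw [← Finset.card_image_of_injective _ ((hci 0).prodMap (hci 0)),
    ← Finset.card_image_of_injective _ ((hci 1).prodMap (hci 1)),
    ← Finset.card_image_of_injective _ (hUi 0 1), ← Finset.card_image_of_injective _ (hUi 1 0),
    ← Finset.card_union_of_disjoint hd₁, ← Finset.card_union_of_disjoint hd₂,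
    ← Finset.card_union_of_disjoint hd₃]
  refine Finset.card_le_card (Finset.union_subset (Finset.union_subset (Finset.union_subset ?_ ?_)
    ?_) ?_)
  · exact fun e he => (hT 0 e he).2.2
  · exact fun e he => (hT 1 e he).2.2
  · exact fun e he => (hU 0 1 (by decide) e he).2.2
  · exact fun e he => (hU 1 0 (by decide) e he).2.2

/-- The discrete cube has edge expansion at least one. -/
theorem card_le_card_cubeBoundary : ∀ {m : ℕ} (F : Finset (Fin m → Fin 2)),
    min F.card (2 ^ m - F.card) ≤ (cubeBoundary F).card
  | 0, F => by
    have h := Finset.card_le_univ F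
    simp only [Fintype.card_unique] at h
    simp only [pow_zero]
    omega
  | m + 1, F => by
    have h₀ := card_le_card_cubeBoundary (cubeSlice F 0)
    have h₁ := card_le_card_cubeBoundary (cubeSlice F 1)
    have h := card_cubeBoundary_slices_le F
    have hF := card_cubeSlice_add F
    have hd₀ := Finset.le_card_sdiff (cubeSlice F 1) (cubeSlice F 0)
    have hd₁ := Finset.le_card_sdiff (cubeSlice F 0) (cubeSlice F 1)
    have hu₀ := Finset.card_le_univ (cubeSlice F 0)
    have hu₁ := Finset.card_le_univ (cubeSlice F 1)
    simp only [Fintype.card_pi, Fintype.card_fin, Finset.prod_const, Finset.card_univ] at hu₀ hu₁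
    rw [pow_succ]
    omega

theorem IsEdgeOf.symm {d : ℕ} {P : Set (Fin d → ℝ)} {u v : Fin d → ℝ} (h : IsEdgeOf P u v) :
    IsEdgeOf P v u :=
  ⟨h.1.symm, segment_symm ℝ u v ▸ h.2⟩

theorem hammingDist_lt_of_between {d : ℕ} {v w y : Fin d → Fin 2}
    (h : ∀ i, y i = v i ∨ y i = w i) (hy : y ≠ w) : hammingDist v y < hammingDist v w := by
  refine Finset.card_lt_card (Finset.ssubset_iff_of_subset ?_ |>.2 ?_)
  · intro i hi
    simp only [Finset.mem_filter, Finset.mem_univ, true_and] at hi ⊢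
    rcases h i with h | h
    · exact absurd h.symm hi
    · rwa [← h]
  · obtain ⟨i, hi⟩ := Function.ne_iff.1 hy
    have hiv := (h i).resolve_right hi
    exact ⟨i, by simpa [← hiv] using hi, by simp [hiv]⟩

/-- A point is adjacent in the polytope to a nearest point of a neighbouring block. -/
theorem exists_isEdgeOf_of_cubeAdj {m k : ℕ} {X : Set (Fin (m + k) → Fin 2)}
    {v : Fin (m + k) → Fin 2} (hv : v ∈ X) {b : Fin m → Fin 2}
    (hb : ∃ w ∈ X, w ∘ Fin.castAdd k = b) (hadj : CubeAdj (v ∘ Fin.castAdd k) b) :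
    ∃ w ∈ X, w ∘ Fin.castAdd k = b ∧
      IsEdgeOf (convexHull ℝ (toCube '' X)) (toCube v) (toCube w) := by
  obtain ⟨w, ⟨hwX, hwb⟩, hmin⟩ := Set.exists_min_image {w | w ∈ X ∧ w ∘ Fin.castAdd k = b}
    (hammingDist v) (Set.toFinite _) hb
  obtain ⟨i, hi⟩ := hadj
  refine ⟨w, hwX, hwb, isEdgeOf_toCube hv hwX (Fin.castAdd k i) ?_ ?_⟩
  · rw [← Function.comp_apply (f := w), hwb]
    exact ((hi i).2 rfl).symm
  · intro y hy hyC
    by_contra! hne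
    refine (hammingDist_lt_of_between hyC hne.2).not_ge (hmin y ⟨hy, ?_⟩)
    funext l
    have hwl : w (Fin.castAdd k l) = b l := congrFun hwb l
    rcases hyC (Fin.castAdd k l) with h | h
    · have hl : l ≠ i := fun hl => hne.1 (hl ▸ h)
      rw [Function.comp_apply, h]
      exact not_ne_iff.1 ((hi l).not.2 hl)
    · exact h.trans hwl

/-- If a block meets both sides of a partition, then some edge crosses inside that block. -/
theorem exists_isEdgeOf_of_mixed {m k : ℕ} {X : Set (Fin (m + k) → Fin 2)}
    {A R : Finset (Fin (m + k) → Fin 2)} (hX : ∀ w, w ∈ X ↔ w ∈ A ∨ w ∈ R) (hAR : Disjoint A R)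
    {b : Fin m → Fin 2} (hA : ∃ u ∈ A, u ∘ Fin.castAdd k = b)
    (hR : ∃ v ∈ R, v ∘ Fin.castAdd k = b) :
    ∃ u ∈ A, ∃ v ∈ R, u ∘ Fin.castAdd k = b ∧ v ∘ Fin.castAdd k = b ∧
      IsEdgeOf (convexHull ℝ (toCube '' X)) (toCube u) (toCube v) := by
  obtain ⟨u₀, hu₀, hu₀b⟩ := hA
  obtain ⟨v₀, hv₀, hv₀b⟩ := hR
  obtain ⟨⟨u, v⟩, ⟨⟨hu, hub⟩, hv, hvb⟩, hmin⟩ := Set.exists_min_image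
    ({u | u ∈ A ∧ u ∘ Fin.castAdd k = b} ×ˢ {v | v ∈ R ∧ v ∘ Fin.castAdd k = b})
    (fun e => hammingDist e.1 e.2) (Set.toFinite _) ⟨(u₀, v₀), ⟨hu₀, hu₀b⟩, hv₀, hv₀b⟩
  have huv : u ≠ v := fun h => Finset.disjoint_left.1 hAR hu (h ▸ hv)
  obtain ⟨j, hj⟩ := Function.ne_iff.1 huv
  refine ⟨u, hu, v, hv, hub, hvb, isEdgeOf_toCube ((hX u).2 (Or.inl hu)) ((hX v).2 (Or.inr hv)) j
    hj.symm fun y hy hyC => ?_⟩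
  by_contra! hne
  have hyu : y ≠ u := fun h => hne.1 (congrFun h j)
  have hyb : y ∘ Fin.castAdd k = b := by
    funext l
    rcases hyC (Fin.castAdd k l) with h | h
    · exact h.trans (congrFun hub l)
    · exact h.trans (congrFun hvb l)
  rcases (hX y).1 hy with h | h
  · have hlt := hammingDist_lt_of_between (fun i => (hyC i).symm) hyu
    rw [hammingDist_comm v, hammingDist_comm v] at hlt
    exact hlt.not_ge (hmin (y, v) ⟨⟨h, hyb⟩, hv, hvb⟩)
  · exact (hammingDist_lt_of_between hyC hne.2).not_ge (hmin (u, y) ⟨⟨hu, hub⟩, h, hyb⟩)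

/-- If every block of `A ∪ R` determined by the first `m` coordinates is nonempty and meets `A` and
`R` in at most `K` points each, then at least `min |A| |R| / K` edges of the polytope join `A` and
`R`. -/
theorem card_le_mul_card_cut {m k K : ℕ} {X : Set (Fin (m + k) → Fin 2)}
    {A R : Finset (Fin (m + k) → Fin 2)} (hX : ∀ w, w ∈ X ↔ w ∈ A ∨ w ∈ R) (hAR : Disjoint A R)
    (hA : ∀ b : Fin m → Fin 2, (A.filter fun w => w ∘ Fin.castAdd k = b).card ≤ K)
    (hR : ∀ b : Fin m → Fin 2, (R.filter fun w => w ∘ Fin.castAdd k = b).card ≤ K)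
    (hne : ∀ b : Fin m → Fin 2, ∃ w ∈ X, w ∘ Fin.castAdd k = b) (hcard : A.card ≤ R.card) :
    A.card ≤ K * ((A ×ˢ R).filter fun e =>
      IsEdgeOf (convexHull ℝ (toCube '' X)) (toCube e.1) (toCube e.2)).card := by
  set β : (Fin (m + k) → Fin 2) → Fin m → Fin 2 := fun w => w ∘ Fin.castAdd k with hβ
  set T := (A ×ˢ R).filter fun e =>
    IsEdgeOf (convexHull ℝ (toCube '' X)) (toCube e.1) (toCube e.2) with hT
  set α := A.image β with hα
  set ρ := R.image β with hρ
  have hmemT : ∀ u ∈ A, ∀ v ∈ R, IsEdgeOf (convexHull ℝ (toCube '' X)) (toCube u) (toCube v) →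
      (β u, β v) ∈ T.image (Prod.map β β) := fun u hu v hv h =>
    Finset.mem_image.2 ⟨(u, v), Finset.mem_filter.2 ⟨Finset.mk_mem_product hu hv, h⟩, rfl⟩
  have hcover : α ∪ ρ = Finset.univ := by
    refine Finset.eq_univ_of_forall fun b => ?_
    obtain ⟨w, hw, rfl⟩ := hne b
    rcases (hX w).1 hw with h | h
    · exact Finset.mem_union_left _ (Finset.mem_image_of_mem β h)
    · exact Finset.mem_union_right _ (Finset.mem_image_of_mem β h)
  have hdiag : (α ∩ ρ).image (fun b => (b, b)) ⊆ T.image (Prod.map β β) := by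
    intro e he
    obtain ⟨b, hb, rfl⟩ := Finset.mem_image.1 he
    obtain ⟨u, hu, v, hv, hub, hvb, h⟩ := exists_isEdgeOf_of_mixed hX hAR
      (Finset.mem_image.1 (Finset.mem_inter.1 hb).1) (Finset.mem_image.1 (Finset.mem_inter.1 hb).2)
    have := hmemT u hu v hv h
    rwa [show β u = b from hub, show β v = b from hvb] at this
  have hfull : cubeBoundary ρᶜ ⊆ T.image (Prod.map β β) := by
    rintro ⟨b, b'⟩ he
    obtain ⟨hb, hb', hadj⟩ := mem_cubeBoundary.1 he
    simp only [Finset.mem_compl, not_not] at hb hb' hadj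
    obtain ⟨v, hv, rfl⟩ := Finset.mem_image.1 hb'
    obtain ⟨u, hu, rfl, h⟩ :=
      exists_isEdgeOf_of_cubeAdj ((hX v).2 (Or.inr hv)) (hne b) hadj.symm
    have huA := ((hX u).1 hu).resolve_right fun hu => hb (Finset.mem_image_of_mem β hu)
    exact hmemT u huA v hv h.symm
  have hempty : cubeBoundary α ⊆ T.image (Prod.map β β) := by
    rintro ⟨b, b'⟩ he
    obtain ⟨hb, hb', hadj⟩ := mem_cubeBoundary.1 he
    simp only at hb hb' hadj
    obtain ⟨u, hu, rfl⟩ := Finset.mem_image.1 hb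
    obtain ⟨v, hv, rfl, h⟩ := exists_isEdgeOf_of_cubeAdj ((hX u).2 (Or.inl hu)) (hne b') hadj
    have hvR := ((hX v).1 hv).resolve_left fun hv => hb' (Finset.mem_image_of_mem β hv)
    exact hmemT u hu v hvR h
  have hbound : ∀ F : Finset (Fin m → Fin 2), cubeBoundary F ⊆ T.image (Prod.map β β) →
      (α ∩ ρ).card + (cubeBoundary F).card ≤ T.card := by
    intro F hF
    have hdisj : Disjoint ((α ∩ ρ).image fun b => (b, b)) (cubeBoundary F) := by
      refine Finset.disjoint_left.2 fun e he he' => ?_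
      obtain ⟨b, -, rfl⟩ := Finset.mem_image.1 he
      obtain ⟨h1, h2, -⟩ := mem_cubeBoundary.1 he'
      exact h2 h1
    rw [← Finset.card_image_of_injective (α ∩ ρ) (f := fun b => (b, b))
      (fun b b' h => (Prod.ext_iff.1 h).1), ← Finset.card_union_of_disjoint hdisj]
    exact (Finset.card_le_card (Finset.union_subset hdiag hF)).trans Finset.card_image_le
  have h₁ := hbound _ hfull
  have h₂ := hbound _ hempty
  have hf := card_le_card_cubeBoundary ρᶜ
  have he := card_le_card_cubeBoundary α
  have hsum := Finset.card_union_add_card_inter α ρ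
  have hρc := Finset.card_compl_add_card ρ
  simp only [hcover, Finset.card_univ, Fintype.card_pi, Fintype.card_fin, Finset.prod_const]
    at hsum hρc
  have hmin : min α.card ρ.card ≤ T.card := by omega
  have hAK : A.card ≤ K * α.card :=
    Finset.card_le_mul_card_image A K fun b _ => hA b
  have hRK : R.card ≤ K * ρ.card :=
    Finset.card_le_mul_card_image R K fun b _ => hR b
  rcases min_le_iff.1 hmin with h | h
  · exact hAK.trans (Nat.mul_le_mul_left K h)
  · exact hcard.trans (hRK.trans (Nat.mul_le_mul_left K h))

/-- If every block of `X` determined by the first `m` coordinates is nonempty and has at most `K`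
points, then the polytope spanned by `X` has edge expansion at least `1 / K`. -/
theorem expansionAtLeast_of_blocks {m k K : ℕ} (X : Set (Fin (m + k) → Fin 2))
    (hsize : ∀ b : Fin m → Fin 2,
      (Finset.univ.filter fun w => w ∘ Fin.castAdd k = b ∧ w ∈ X).card ≤ K)
    (hne : X.Nonempty → ∀ b : Fin m → Fin 2, ∃ w ∈ X, w ∘ Fin.castAdd k = b) :
    ExpansionAtLeast (convexHull ℝ (toCube '' X)) (1 / (K : ℝ)) := by
  intro S hS hSne hcard
  rw [polyVerts_convexHull_toCube] at hS hcard
  set A := Finset.univ.filter fun w => w ∈ X ∧ toCube w ∈ S with hA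
  set R := Finset.univ.filter fun w => w ∈ X ∧ toCube w ∉ S with hR
  have hX : ∀ w, w ∈ X ↔ w ∈ A ∨ w ∈ R := by
    intro w
    simp only [hA, hR, Finset.mem_filter, Finset.mem_univ, true_and]
    tauto
  have hAR : Disjoint A R := Finset.disjoint_left.2 fun w h h' =>
    (Finset.mem_filter.1 h').2.2 (Finset.mem_filter.1 h).2.2
  have hSA : S = toCube '' (A : Set (Fin (m + k) → Fin 2)) := by
    ext x
    constructor
    · intro hx
      obtain ⟨w, hw, rfl⟩ := hS hx
      exact ⟨w, by simp [hA, hw, hx], rfl⟩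
    · rintro ⟨w, hw, rfl⟩
      exact (Finset.mem_filter.1 hw).2.2
  have hXAR : X = ((A ∪ R : Finset _) : Set (Fin (m + k) → Fin 2)) := by
    ext w
    simp [hX]
  have hScard : S.ncard = A.card := by
    rw [hSA, Set.ncard_image_of_injective _ toCube_injective, Set.ncard_coe_finset]
  have hXcard : (toCube '' X).ncard = A.card + R.card := by
    rw [Set.ncard_image_of_injective _ toCube_injective, hXAR, Set.ncard_coe_finset,
      Finset.card_union_of_disjoint hAR]
  have hle : A.card ≤ R.card := by omega
  have hXne : X.Nonempty := by
    obtain ⟨x, hx⟩ := hSne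
    obtain ⟨w, hw, -⟩ := hS hx
    exact ⟨w, hw⟩
  have hAK : ∀ b : Fin m → Fin 2, (A.filter fun w => w ∘ Fin.castAdd k = b).card ≤ K := by
    refine fun b => (Finset.card_le_card fun w hw => ?_).trans (hsize b)
    simp only [hA, Finset.mem_filter, Finset.mem_univ, true_and] at hw ⊢
    exact ⟨hw.2, hw.1.1⟩
  have hRK : ∀ b : Fin m → Fin 2, (R.filter fun w => w ∘ Fin.castAdd k = b).card ≤ K := by
    refine fun b => (Finset.card_le_card fun w hw => ?_).trans (hsize b)
    simp only [hR, Finset.mem_filter, Finset.mem_univ, true_and] at hw ⊢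
    exact ⟨hw.2, hw.1.1⟩
  have hmain := card_le_mul_card_cut hX hAR hAK hRK (hne hXne) hle
  set T := (A ×ˢ R).filter fun e =>
    IsEdgeOf (convexHull ℝ (toCube '' X)) (toCube e.1) (toCube e.2) with hT
  have hcut : T.card ≤ cutCard (convexHull ℝ (toCube '' X)) S := by
    rw [← Set.ncard_coe_finset, ← Set.ncard_image_of_injective _
      (toCube_injective.prodMap toCube_injective)]
    refine Set.ncard_le_ncard ?_ ?_
    · rintro _ ⟨e, he, rfl⟩
      obtain ⟨he, hedge⟩ := Finset.mem_filter.1 he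
      obtain ⟨h1, h2⟩ := Finset.mem_product.1 he
      exact ⟨hedge, (Finset.mem_filter.1 h1).2.2, (Finset.mem_filter.1 h2).2.2⟩
    · have hfin : (toCube '' X).Finite := Set.toFinite _
      exact (hfin.prod hfin).subset fun e he => ⟨hS he.2.1, he.1.right_mem_of_convexHull⟩
  rw [hScard]
  have hreal : (A.card : ℝ) ≤ K * cutCard (convexHull ℝ (toCube '' X)) S := by
    exact_mod_cast hmain.trans (Nat.mul_le_mul_left K hcut)
  rcases Nat.eq_zero_or_pos K with hK | hK
  · simp [hK]
  · have hK' : (0 : ℝ) < K := by exact_mod_cast hK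
    rw [one_div, inv_mul_le_iff₀ hK']
    exact hreal

/-- The probability of the configuration `ω` when each point is present with probability `p`. -/
noncomputable def binomWeight {V : Type*} [Fintype V] (p : ℝ) (ω : V → Bool) : ℝ :=
  ∏ v, if ω v then p else 1 - p

theorem binomWeight_nonneg {V : Type*} [Fintype V] {p : ℝ} (hp : 0 ≤ p) (hp' : p ≤ 1)
    (ω : V → Bool) : 0 ≤ binomWeight p ω :=
  Finset.prod_nonneg fun v _ => by split_ifs <;> linarith

/-- The probability generating function of the number of chosen points in `B`. -/
theorem sum_binomWeight_mul_pow {V : Type*} [Fintype V] [DecidableEq V] (p z : ℝ)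
    (B : V → Prop) [DecidablePred B] :
    ∑ ω : V → Bool, binomWeight p ω * z ^ (Finset.univ.filter fun v => B v ∧ ω v = true).card =
      (1 + p * (z - 1)) ^ (Finset.univ.filter B).card := by
  have h : ∀ ω : V → Bool,
      binomWeight p ω * z ^ (Finset.univ.filter fun v => B v ∧ ω v = true).card =
        ∏ v, (if ω v then p else 1 - p) * (if B v ∧ ω v = true then z else 1) := by
    intro ω
    rw [Finset.prod_mul_distrib, ← Finset.prod_filter, Finset.prod_const, binomWeight]
  simp_rw [h]
  rw [← Fintype.prod_sum fun v (b : Bool) =>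
    (if b then p else 1 - p) * (if B v ∧ b = true then z else 1)]
  rw [← Finset.prod_const, ← Finset.prod_filter_mul_prod_filter_not Finset.univ B]
  rw [Finset.prod_eq_one (s := Finset.univ.filter fun v => ¬ B v), mul_one]
  · refine Finset.prod_congr rfl fun v hv => ?_
    simp [(Finset.mem_filter.1 hv).2]
    ring
  · intro v hv
    simp [(Finset.mem_filter.1 hv).2]

theorem sum_binomWeight {V : Type*} [Fintype V] [DecidableEq V] (p : ℝ) :
    ∑ ω : V → Bool, binomWeight p ω = 1 := by
  simpa using sum_binomWeight_mul_pow (V := V) p 1 fun _ => True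

/-- Markov's inequality in the form of a lower bound on the probability of `A`. -/
theorem one_sub_le_binomProb {d : ℕ} {p δ : ℝ} (hp : 0 ≤ p) (hp' : p ≤ 1)
    (A : Set ((Fin d → Fin 2) → Bool)) (f : ((Fin d → Fin 2) → Bool) → ℝ) (hf : ∀ ω, 0 ≤ f ω)
    (hA : ∀ ω, ω ∉ A → 1 ≤ f ω) (hδ : ∑ ω, binomWeight p ω * f ω ≤ δ) :
    1 - δ ≤ binomProb d p A := by
  have hsplit := Finset.sum_filter_add_sum_filter_not Finset.univ (· ∈ A)
    (binomWeight (V := Fin d → Fin 2) p)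
  rw [sum_binomWeight] at hsplit
  have hbad : ∑ ω ∈ Finset.univ.filter (· ∉ A), binomWeight p ω ≤ δ := by
    refine le_trans ?_ hδ
    refine (Finset.sum_le_sum fun ω hω => ?_).trans
      (Finset.sum_le_sum_of_subset_of_nonneg (Finset.filter_subset _ _) fun ω _ _ =>
        mul_nonneg (binomWeight_nonneg hp hp' ω) (hf ω))
    exact le_mul_of_one_le_right (binomWeight_nonneg hp hp' ω) (hA ω (Finset.mem_filter.1 hω).2)
  have : binomProb d p A = ∑ ω ∈ Finset.univ.filter (· ∈ A), binomWeight p ω := rfl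
  linarith

theorem card_block (m k : ℕ) (b : Fin m → Fin 2) :
    (Finset.univ.filter fun w : Fin (m + k) → Fin 2 => w ∘ Fin.castAdd k = b).card = 2 ^ k := by
  have h : (Finset.univ.filter fun w : Fin (m + k) → Fin 2 => w ∘ Fin.castAdd k = b) =
      Finset.univ.image (Fin.append b) := by
    ext w
    simp only [Finset.mem_filter, Finset.mem_univ, true_and, Finset.mem_image]
    constructor
    · rintro rfl
      exact ⟨w ∘ Fin.natAdd m, Fin.append_castAdd_natAdd⟩
    · rintro ⟨x, rfl⟩
      funext i
      simp
  rw [h, Finset.card_image_of_injective]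
  · simp
  · intro x y hxy
    funext i
    simpa using congrFun hxy (Fin.natAdd m i)

/-- If the expected block size is at most `2 d`, and at least `d` unless there is a single block,
then the expansion bound `1 / (12 d)` fails with exponentially small probability. -/
theorem one_sub_le_binomProb_expansion {m k : ℕ} {p : ℝ} (hp : 0 < p) (hp' : p < 1)
    (hub : 2 ^ k * p ≤ 2 * (m + k : ℕ)) (hlb : m ≠ 0 → ((m + k : ℕ) : ℝ) ≤ 2 ^ k * p) :
    1 - ((2 * Real.exp (-1)) ^ (m + k) + (2 * (Real.exp 2 / 2 ^ 12)) ^ (m + k)) ≤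
      binomProb (m + k) p {ω | ExpansionAtLeast (convexHull ℝ (toCube '' {w | ω w = true}))
        (1 / (12 * ((m + k : ℕ) : ℝ)))} := by
  set d := m + k with hd
  set N : ((Fin (m + k) → Fin 2) → Bool) → (Fin m → Fin 2) → ℕ := fun ω b =>
    (Finset.univ.filter fun w => w ∘ Fin.castAdd k = b ∧ ω w = true).card with hN
  set χ : ℝ := if m = 0 then 0 else 1 with hχ
  have hχ0 : 0 ≤ χ := by
    rw [hχ]
    split_ifs <;> norm_num
  have hpgf : ∀ z b, ∑ ω, binomWeight p ω * z ^ N ω b = (1 + p * (z - 1)) ^ 2 ^ k := by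
    intro z b
    rw [sum_binomWeight_mul_pow p z fun w => w ∘ Fin.castAdd k = b, card_block]
  refine one_sub_le_binomProb hp.le hp'.le _
    (fun ω => ∑ b, (χ * 0 ^ N ω b + 2 ^ N ω b * (2 ^ (12 * d))⁻¹)) ?_ ?_ ?_
  · exact fun ω => Finset.sum_nonneg fun b _ => by positivity
  · intro ω hω
    have hterm : ∃ b, 1 ≤ χ * 0 ^ N ω b + (2 : ℝ) ^ N ω b * (2 ^ (12 * d))⁻¹ := by
      by_contra! hlt
      refine hω ?_
      have := expansionAtLeast_of_blocks (K := 12 * d) {w | ω w = true} (fun b => ?_) ?_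
      · simpa using this
      · by_contra! hgt
        have hgt' : 12 * d ≤ N ω b := by
          refine hgt.le.trans_eq (congrArg Finset.card ?_)
          ext w
          simp
        have h2 : (2 : ℝ) ^ (12 * d) ≤ 2 ^ N ω b := pow_le_pow_right₀ (by norm_num) hgt'
        have h3 : 1 ≤ (2 : ℝ) ^ N ω b * (2 ^ (12 * d))⁻¹ := by
          rwa [← div_eq_mul_inv, one_le_div (by positivity)]
        have h4 : 0 ≤ χ * (0 : ℝ) ^ N ω b := by positivity
        linarith [hlt b]
      · rintro ⟨w₀, hw₀⟩ b
        by_cases hm : m = 0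
        · subst hm
          exact ⟨w₀, hw₀, Subsingleton.elim _ _⟩
        · by_contra! hno
          have hN0 : N ω b = 0 := Finset.card_eq_zero.2 <|
            Finset.filter_eq_empty_iff.2 fun w _ h => hno w h.2 h.1
          have := hlt b
          rw [hN0, hχ, if_neg hm] at this
          have h4 : (0 : ℝ) < 2 ^ 0 * (2 ^ (12 * d))⁻¹ := by positivity
          simp only [pow_zero, mul_one] at this h4
          linarith
    obtain ⟨b, hb⟩ := hterm
    exact hb.trans (Finset.single_le_sum
      (f := fun b => χ * 0 ^ N ω b + (2 : ℝ) ^ N ω b * (2 ^ (12 * d))⁻¹)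
      (fun b _ => by positivity) (Finset.mem_univ b))
  · have hsum : ∑ ω, binomWeight p ω * ∑ b, (χ * 0 ^ N ω b + 2 ^ N ω b * (2 ^ (12 * d))⁻¹) =
        2 ^ m * (χ * (1 - p) ^ 2 ^ k + (1 + p) ^ 2 ^ k * (2 ^ (12 * d))⁻¹) := by
      simp_rw [Finset.mul_sum]
      rw [Finset.sum_comm]
      have hb : ∀ b, ∑ ω, binomWeight p ω * (χ * 0 ^ N ω b + 2 ^ N ω b * (2 ^ (12 * d))⁻¹) =
          χ * (1 - p) ^ 2 ^ k + (1 + p) ^ 2 ^ k * (2 ^ (12 * d))⁻¹ := by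
        intro b
        have h0 := hpgf 0 b
        have h2 := hpgf 2 b
        rw [show 1 + p * (0 - 1) = 1 - p by ring] at h0
        rw [show 1 + p * (2 - 1) = 1 + p by ring] at h2
        rw [← h0, ← h2, Finset.mul_sum, Finset.sum_mul, ← Finset.sum_add_distrib]
        exact Finset.sum_congr rfl fun ω _ => by ring
      simp [hb]
      ring
    rw [hsum]
    have h2m : (2 : ℝ) ^ m ≤ 2 ^ d := pow_le_pow_right₀ (by norm_num) (by omega)
    have hlow : χ * (1 - p) ^ 2 ^ k ≤ Real.exp (-1) ^ d := by
      by_cases hm : m = 0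
      · rw [hχ, if_pos hm, zero_mul]
        positivity
      · rw [hχ, if_neg hm, one_mul]
        calc (1 - p) ^ 2 ^ k ≤ Real.exp (-p) ^ 2 ^ k :=
              pow_le_pow_left₀ (by linarith) (Real.one_sub_le_exp_neg p) _
          _ = Real.exp (-(2 ^ k * p)) := by
              rw [← Real.exp_nat_mul]
              push_cast
              ring_nf
          _ ≤ Real.exp (-(d : ℝ)) := Real.exp_le_exp.2 (neg_le_neg (hlb hm))
          _ = Real.exp (-1) ^ d := by
              rw [← Real.exp_nat_mul]
              ring_nf
    have hupp : (1 + p) ^ 2 ^ k ≤ Real.exp 2 ^ d := by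
      calc (1 + p) ^ 2 ^ k ≤ Real.exp p ^ 2 ^ k :=
            pow_le_pow_left₀ (by linarith) (by linarith [Real.add_one_le_exp p]) _
        _ = Real.exp (2 ^ k * p) := by
            rw [← Real.exp_nat_mul]
            push_cast
            ring_nf
        _ ≤ Real.exp (2 * (d : ℝ)) := Real.exp_le_exp.2 hub
        _ = Real.exp 2 ^ d := by
            rw [← Real.exp_nat_mul]
            ring_nf
    have hnonneg : 0 ≤ χ * (1 - p) ^ 2 ^ k + (1 + p) ^ 2 ^ k * (2 ^ (12 * d))⁻¹ := by
      have : 0 ≤ 1 - p := by linarith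
      positivity
    calc 2 ^ m * (χ * (1 - p) ^ 2 ^ k + (1 + p) ^ 2 ^ k * (2 ^ (12 * d))⁻¹)
        ≤ 2 ^ d * (Real.exp (-1) ^ d + Real.exp 2 ^ d * (2 ^ (12 * d))⁻¹) := by gcongr
      _ = _ := by
        rw [mul_pow, mul_pow, div_pow, ← pow_mul]
        ring

/-- One can choose the block dimension `k` so that the expected block size is of order `d`. -/
theorem exists_block_dimension {d : ℕ} (hd : 1 ≤ d) {p : ℝ} (hp' : p < 1) :
    ∃ m k : ℕ, d = m + k ∧ 2 ^ k * p ≤ 2 * (d : ℝ) ∧ (m ≠ 0 → (d : ℝ) ≤ 2 ^ k * p) := by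
  have hd' : (1 : ℝ) ≤ d := by exact_mod_cast hd
  by_cases h : ∃ k, k ≤ d ∧ (d : ℝ) ≤ 2 ^ k * p
  · obtain ⟨hkd, hk⟩ := Nat.find_spec h
    refine ⟨d - Nat.find h, Nat.find h, by omega, ?_, fun _ => hk⟩
    rcases hk0 : Nat.find h with _ | j
    · rw [pow_zero]
      linarith
    · have := Nat.find_min h (m := j) (by omega)
      push Not at this
      have hj := this (by omega)
      rw [pow_succ]
      linarith
  · push Not at h
    refine ⟨0, d, by omega, ?_, fun h => absurd rfl h⟩
    linarith [h d le_rfl]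

theorem tendsto_failure_bound :
    Filter.Tendsto
      (fun d : ℕ => (2 * Real.exp (-1)) ^ d + (2 * (Real.exp 2 / 2 ^ 12)) ^ d)
      Filter.atTop (nhds 0) := by
  have he : (2 : ℝ) < Real.exp 1 := by linarith [Real.exp_one_gt_d9]
  have he' : Real.exp 1 < 3 := by linarith [Real.exp_one_lt_d9]
  have h1 : 2 * Real.exp (-1) < 1 := by
    rw [Real.exp_neg, ← div_eq_mul_inv, div_lt_one (Real.exp_pos 1)]
    exact he
  have h2 : 2 * (Real.exp 2 / 2 ^ 12) < 1 := by
    have : Real.exp 2 = Real.exp 1 * Real.exp 1 := by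
      rw [← Real.exp_add]
      norm_num
    rw [this]
    nlinarith
  simpa using (tendsto_pow_atTop_nhds_zero_of_lt_one (by positivity) h1).add
    (tendsto_pow_atTop_nhds_zero_of_lt_one (by positivity) h2)

/-- Main theorem, binomial model: for `p ∈ (0,1)`, let `S` be the random subset of
`{0,1}^d` containing each point independently with probability `p` and `P = conv S`.
Then with probability tending to 1 as `d → ∞` (uniformly in `p`), the edge expansion
of the graph of `P` is at least `1/(12d)`. -/
theorem main_binomial :
    ∀ ε : ℝ, 0 < ε → ∃ D : ℕ, ∀ d : ℕ, D ≤ d → ∀ p : ℝ, 0 < p → p < 1 →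
      1 - ε ≤
        binomProb d p
          {ω | ExpansionAtLeast
              (convexHull ℝ (toCube '' {w | ω w = true}))
              (1 / (12 * (d : ℝ)))} := by
  intro ε hε
  obtain ⟨D, hD⟩ := Filter.eventually_atTop.1 (tendsto_failure_bound.eventually (ge_mem_nhds hε))
  refine ⟨max D 1, fun d hd p hp hp' => ?_⟩
  obtain ⟨m, k, rfl, hub, hlb⟩ := exists_block_dimension (le_of_max_le_right hd) hp'
  have hδ := hD _ (le_of_max_le_left hd)
  exact (sub_le_sub_left hδ 1).trans (one_sub_le_binomProb_expansion hp hp' hub hlb)
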